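/- arXiv:0812.4776 — 2 statements merged into one kernel-verified Lean document; each statement's English description precedes it below -/
import Mathlib

section
/- Consistency of the form factors with the sine-Gordon equation of motion: for every odd N ≥ 1 and every admissible tuple X = (x_1,…,x_N), S_1(X) · S_{−1}(X) · (d/da J_{N,a}(X))|_{a = −1/2} = (π / sin πp) · J̃_N(X), where J̃_N(X) denotes J_{N,a}(X) evaluated at the parameter value a = p − 1/2, i.e., with e^{iπa} replaced by −iω. (Here a ↦ J_{N,a}(X) is an entire function of a, being a finite sum of exponentials in a with constant coefficients.) -/
open Finset Filter Complex

/-- The function `f(x) = (x+ω)(x−ω⁻¹)/(x²−1)`. -/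
noncomputable def ff (ω x : ℂ) : ℂ := (x + ω) * (x - ω⁻¹) / (x ^ 2 - 1)

/-- The power sum `S_m` (with `m ∈ ℤ`) of the entries `X i`, `i ∈ I`. -/
noncomputable def pS (m : ℤ) {N : ℕ} (X : Fin N → ℂ) (I : Finset (Fin N)) : ℂ :=
  ∑ i ∈ I, X i ^ m

/-- The polynomial `P^h(X_-|X_+) = ∏_{m=1}^s (S_m(X_-) − (−1)^m S_m(X_+))^{k_m}` of the
partition `h` with multiplicities `k` (with `k m` parts equal to `m`, `1 ≤ m ≤ s`),
evaluated on the entries of `X` indexed by `Im` and `Ip`. -/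
noncomputable def Ph (k : ℕ → ℕ) (s : ℕ) {N : ℕ} (X : Fin N → ℂ)
    (Im Ip : Finset (Fin N)) : ℂ :=
  ∏ m ∈ Finset.Icc 1 s, (pS (m : ℤ) X Im - (-1 : ℂ) ^ m * pS (m : ℤ) X Ip) ^ k m

/-- A tuple is admissible if all entries are nonzero and `x_i ≠ ±x_j` for `i ≠ j`. -/
def Admissible {N : ℕ} (X : Fin N → ℂ) : Prop :=
  (∀ i, X i ≠ 0) ∧ ∀ i j, i ≠ j → X i ≠ X j ∧ X i ≠ -X j

/-- The phase factor `e^{iπa(#I_- − #I_+)}` where `#I_- = c`, `#I_+ = N − c`. -/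
noncomputable def phase (a : ℂ) (N c : ℕ) : ℂ :=
  Complex.exp (Complex.I * (Real.pi : ℂ) * a * (2 * (c : ℂ) - (N : ℂ)))

/-- The descendant function
`J^h_{N,a}(X) = Σ_{I_- ⊔ I_+} e^{iπa(#I_- − #I_+)} P^h(X_-|X_+) ∏_{i∈I_-, j∈I_+} f(x_i/x_j)`. -/
noncomputable def J (ω : ℂ) (k : ℕ → ℕ) (s : ℕ) (a : ℂ) {N : ℕ} (X : Fin N → ℂ) : ℂ :=
  ∑ I : Finset (Fin N),
    phase a N I.card * Ph k s X I Iᶜ * ∏ i ∈ I, ∏ j ∈ Iᶜ, ff ω (X i / X j)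

/-- The exponential-field function `J_{N,a}(X)` (the case `P^h = 1`). -/
noncomputable def Jexp (ω a : ℂ) {N : ℕ} (X : Fin N → ℂ) : ℂ :=
  ∑ I : Finset (Fin N),
    phase a N I.card * ∏ i ∈ I, ∏ j ∈ Iᶜ, ff ω (X i / X j)

/-- The function `J̃_N(X)`: the exponential-field `J` function at the parameter value
`a = p − 1/2`, i.e. with `e^{iπa}` replaced by `−iω`. -/
noncomputable def Jtilde (ω : ℂ) {N : ℕ} (X : Fin N → ℂ) : ℂ :=
  ∑ I : Finset (Fin N),
    (-(Complex.I * ω)) ^ (2 * (I.card : ℤ) - (N : ℤ)) *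
      ∏ i ∈ I, ∏ j ∈ Iᶜ, ff ω (X i / X j)

open scoped Topology

/-- Liouville with finitely many removable singularities. -/
theorem eq_zero_of_removable_of_tendsto_cocompact (S : Finset ℂ) :
    ∀ F : ℂ → ℂ, (∀ z ∉ S, DifferentiableAt ℂ F z) →
      (∀ s ∈ S, Tendsto (fun z => (z - s) * F z) (𝓝[≠] s) (𝓝 0)) →
      Tendsto F (cocompact ℂ) (𝓝 0) → ∀ z ∉ S, F z = 0 := by
  induction S using Finset.induction_on with
  | empty =>
    intro F hd _ hinf z _
    exact Differentiable.apply_eq_of_tendsto_cocompact (fun z => hd z (by simp)) z hinf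
  | insert s S hs ih =>
    intro F hd hr hinf z hz
    set G := Function.update F s (limUnder (𝓝[≠] s) F) with hG
    have hGF : ∀ w, w ≠ s → G =ᶠ[𝓝 w] F := fun w hw => by
      filter_upwards [isOpen_ne.mem_nhds hw] with u hu
      exact Function.update_of_ne hu _ _
    have hopen : ((S : Set ℂ))ᶜ ∈ 𝓝 s :=
      S.finite_toSet.isClosed.isOpen_compl.mem_nhds (by simpa using hs)
    have hGs : DifferentiableAt ℂ G s := by
      refine (differentiableOn_update_limUnder_of_isLittleO hopen ?_ ?_).differentiableAt hopen
      · intro w hw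
        exact (hd w (by simpa [not_or] using ⟨hw.2, hw.1⟩)).differentiableWithinAt
      · rw [Asymptotics.isLittleO_iff_tendsto']
        · have h1 := hr s (mem_insert_self _ _)
          have h2 : Tendsto (fun z => (z - s) * F s) (𝓝[≠] s) (𝓝 0) := by
            have : ContinuousAt (fun z : ℂ => (z - s) * F s) s := by fun_prop
            simpa using this.tendsto.mono_left nhdsWithin_le_nhds
          have h3 := h1.sub h2
          rw [sub_zero] at h3
          refine h3.congr fun u => ?_
          rw [div_inv_eq_mul]; ring
        · filter_upwards [self_mem_nhdsWithin] with u hu h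
          exact absurd (sub_eq_zero.mp (inv_eq_zero.mp h)) hu
    have hzs : z ≠ s := fun h => hz (by simp [h])
    have hGz := ih G ?_ ?_ ?_ z (fun h => hz (mem_insert_of_mem h))
    · rwa [(hGF z hzs).eq_of_nhds] at hGz
    · intro w hw
      by_cases h : w = s
      · exact h ▸ hGs
      · exact (hd w (by simp [h, hw])).congr_of_eventuallyEq (hGF w h)
    · intro w hw
      have hws : w ≠ s := fun h => hs (h ▸ hw)
      refine (hr w (mem_insert_of_mem hw)).congr' ?_
      filter_upwards [(hGF w hws).filter_mono nhdsWithin_le_nhds] with u hu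
      rw [hu]
    · refine hinf.congr' ?_
      filter_upwards [(isCompact_singleton (x := s)).compl_mem_cocompact] with u hu
      exact (Function.update_of_ne hu _ _).symm

theorem tendsto_inv_cocompact_complex :
    Tendsto (fun z : ℂ => z⁻¹) (cocompact ℂ) (𝓝 0) := by
  rw [← Metric.cobounded_eq_cocompact]; exact tendsto_inv₀_cobounded

/-- The two-particle factor `1 + c x y / (x² - y²)`. -/
noncomputable def kern (c x y : ℂ) : ℂ := 1 + c * x * y / (x ^ 2 - y ^ 2)

theorem kern_neg_left (c x y : ℂ) : kern c (-x) y = kern c y x := by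
  unfold kern
  rw [← neg_sub (y ^ 2) ((-x) ^ 2), div_neg, ← neg_div]
  congr 2 <;> ring

theorem kern_neg_right (c x y : ℂ) : kern c x (-y) = kern c y x := by
  unfold kern
  rw [← neg_sub ((-y) ^ 2) (x ^ 2), div_neg, ← neg_div]
  congr 2 <;> ring

theorem kern_swap (c x y : ℂ) : kern c x y = kern (-c) y x := by
  unfold kern
  rw [← neg_sub (y ^ 2) (x ^ 2), div_neg, ← neg_div]
  congr 2; ring

theorem differentiableAt_kern_left {c y z : ℂ} (h : z ^ 2 ≠ y ^ 2) :
    DifferentiableAt ℂ (fun z => kern c z y) z := by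
  unfold kern
  exact (differentiableAt_const _).add
    (DifferentiableAt.div (by fun_prop) (by fun_prop) (sub_ne_zero.mpr h))

theorem differentiableAt_kern_right {c y z : ℂ} (h : z ^ 2 ≠ y ^ 2) :
    DifferentiableAt ℂ (fun z => kern c y z) z := by
  simp_rw [kern_swap c y]
  exact differentiableAt_kern_left h

theorem tendsto_mul_kern_sub_one (c y : ℂ) :
    Tendsto (fun z => z * (kern c z y - 1)) (cocompact ℂ) (𝓝 (c * y)) := by
  have hc : ContinuousAt (fun u : ℂ => c * y / (1 - u ^ 2 * y ^ 2)) 0 :=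
    ContinuousAt.div (by fun_prop) (by fun_prop) (by simp)
  have h := hc.tendsto.comp tendsto_inv_cocompact_complex
  simp only [ne_eq, OfNat.ofNat_ne_zero, not_false_eq_true, zero_pow, zero_mul, sub_zero,
    div_one] at h
  refine h.congr' ?_
  filter_upwards [(isCompact_singleton (x := (0 : ℂ))).compl_mem_cocompact,
    (isCompact_singleton (x := y)).compl_mem_cocompact,
    (isCompact_singleton (x := -y)).compl_mem_cocompact] with z h0 h1 h2
  have h0 : z ≠ 0 := h0
  have h12 : z ^ 2 - y ^ 2 ≠ 0 := by
    rw [sq_sub_sq]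
    exact mul_ne_zero (fun h => h2 (eq_neg_of_add_eq_zero_left h)) (sub_ne_zero.mpr h1)
  have h4 : 1 - z⁻¹ ^ 2 * y ^ 2 = z⁻¹ ^ 2 * (z ^ 2 - y ^ 2) := by field_simp
  simp only [Function.comp, kern, h4]
  field_simp
  ring

theorem tendsto_of_tendsto_mul_sub_one {f : ℂ → ℂ} {a : ℂ}
    (h : Tendsto (fun z => z * (f z - 1)) (cocompact ℂ) (𝓝 a)) :
    Tendsto f (cocompact ℂ) (𝓝 1) := by
  have h1 := (tendsto_inv_cocompact_complex.mul h).add_const 1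
  rw [zero_mul, zero_add] at h1
  refine h1.congr' ?_
  filter_upwards [(isCompact_singleton (x := (0 : ℂ))).compl_mem_cocompact] with z h0
  have h0 : z ≠ 0 := h0
  field_simp
  ring

theorem tendsto_mul_prod_kern_sub_one {ι : Type*} [DecidableEq ι] (c : ℂ) (x : ι → ℂ)
    (I : Finset ι) :
    Tendsto (fun z => z * (∏ j ∈ I, kern c z (x j) - 1)) (cocompact ℂ)
      (𝓝 (c * ∑ j ∈ I, x j)) := by
  induction I using Finset.induction_on with
  | empty => simp
  | insert b I hb ih =>
    have h1 := tendsto_mul_kern_sub_one c (x b)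
    have h2 := (h1.mul (tendsto_of_tendsto_mul_sub_one ih)).add ih
    rw [sum_insert hb, mul_add]
    rw [mul_one] at h2
    refine h2.congr fun z => ?_
    rw [prod_insert hb]; ring

theorem differentiableAt_prod_kern_left {ι : Type*} {c : ℂ} {x : ι → ℂ} {I : Finset ι} {z : ℂ}
    (h : ∀ i ∈ I, z ^ 2 ≠ x i ^ 2) :
    DifferentiableAt ℂ (fun z => ∏ j ∈ I, kern c z (x j)) z :=
  DifferentiableAt.fun_finsetProd fun i hi => differentiableAt_kern_left (h i hi)

theorem differentiableAt_prod_kern_right {ι : Type*} {c : ℂ} {x : ι → ℂ} {I : Finset ι} {z : ℂ}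
    (h : ∀ i ∈ I, z ^ 2 ≠ x i ^ 2) :
    DifferentiableAt ℂ (fun z => ∏ j ∈ I, kern c (x j) z) z :=
  DifferentiableAt.fun_finsetProd fun i hi => differentiableAt_kern_right (h i hi)

section

variable {ι : Type*} [DecidableEq ι]

/-- The weight `∏_{i ∈ I, j ∈ s \ I} kern c (x i) (x j)` of the splitting `I ⊔ (s \ I)`. -/
noncomputable def wt (c : ℂ) (x : ι → ℂ) (s I : Finset ι) : ℂ :=
  ∏ i ∈ I, ∏ j ∈ s \ I, kern c (x i) (x j)

theorem wt_insert_left (c : ℂ) (x : ι → ℂ) {s I : Finset ι} {a : ι} (ha : a ∉ s) (hI : I ⊆ s) :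
    wt c x (insert a s) I = wt c x s I * ∏ i ∈ I, kern c (x i) (x a) := by
  have haI : a ∉ I := fun h => ha (hI h)
  unfold wt
  rw [insert_sdiff_of_notMem _ haI, ← prod_mul_distrib]
  refine prod_congr rfl fun i _ => ?_
  rw [prod_insert (by simp [ha]), mul_comm]

theorem wt_insert_insert (c : ℂ) (x : ι → ℂ) {s I : Finset ι} {a : ι} (ha : a ∉ s) (hI : I ⊆ s) :
    wt c x (insert a s) (insert a I) = wt c x s I * ∏ j ∈ s \ I, kern c (x a) (x j) := by
  have haI : a ∉ I := fun h => ha (hI h)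
  unfold wt
  rw [insert_sdiff_insert, sdiff_insert_of_notMem ha, prod_insert haI, mul_comm]

/-- The weighted sum over splittings of `s` together with one further particle at `z`. The
weight is `φ₁ I z` if the particle is added to `I`, and `φ₀ I z` otherwise. -/
noncomputable def extSum (c : ℂ) (x : ι → ℂ) (s : Finset ι) (φ₁ φ₀ : Finset ι → ℂ → ℂ)
    (z : ℂ) : ℂ :=
  ∑ I ∈ s.powerset, wt c x s I *
    (φ₁ I z * ∏ j ∈ s \ I, kern c z (x j) + φ₀ I z * ∏ i ∈ I, kern c (x i) z)

theorem sum_powerset_insert_wt (c : ℂ) (x : ι → ℂ) {s : Finset ι} {a : ι} (ha : a ∉ s)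
    (φ : Finset ι → ℂ) :
    ∑ I ∈ (insert a s).powerset, φ I * wt c x (insert a s) I =
      extSum c x s (fun I _ => φ (insert a I)) (fun I _ => φ I) (x a) := by
  rw [sum_powerset_insert ha, extSum, ← sum_add_distrib]
  refine sum_congr rfl fun I hI => ?_
  rw [wt_insert_left c x ha (mem_powerset.mp hI), wt_insert_insert c x ha (mem_powerset.mp hI)]
  ring

/-- The limit of `(z - σ y) kern c z y` at the pole `σ y`, `σ = ±1`. -/
theorem tendsto_sub_mul_kern_left {c y σ : ℂ} (hy : y ≠ 0) (hσ : σ ^ 2 = 1) :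
    Tendsto (fun z => (z - σ * y) * kern c z y) (𝓝[≠] (σ * y)) (𝓝 (c * y / 2)) := by
  have hσ0 : σ ≠ 0 := by rintro rfl; simp at hσ
  have h2 : σ * y + σ * y ≠ 0 := by
    rw [← two_mul]; exact mul_ne_zero two_ne_zero (mul_ne_zero hσ0 hy)
  have hc : ContinuousAt (fun z : ℂ => (z - σ * y) + c * z * y / (z + σ * y)) (σ * y) :=
    ContinuousAt.add (by fun_prop) (ContinuousAt.div (by fun_prop) (by fun_prop) h2)
  have h := hc.tendsto.mono_left (nhdsWithin_le_nhds (s := {σ * y}ᶜ))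
  have hv : σ * y - σ * y + c * (σ * y) * y / (σ * y + σ * y) = c * y / 2 := by
    field_simp; ring
  rw [hv] at h
  refine h.congr' ?_
  have hne : ∀ᶠ z in 𝓝[≠] (σ * y), z + σ * y ≠ 0 :=
    nhdsWithin_le_nhds
      ((by fun_prop : ContinuousAt (fun z : ℂ => z + σ * y) (σ * y)).eventually_ne h2)
  filter_upwards [self_mem_nhdsWithin, hne] with z hz hz'
  have hz1 : z - σ * y ≠ 0 := sub_ne_zero.mpr hz
  have : z ^ 2 - y ^ 2 = (z - σ * y) * (z + σ * y) := by linear_combination (y ^ 2) * hσ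
  rw [kern, this]
  field_simp

theorem tendsto_sub_mul_kern_right {c y σ : ℂ} (hy : y ≠ 0) (hσ : σ ^ 2 = 1) :
    Tendsto (fun z => (z - σ * y) * kern c y z) (𝓝[≠] (σ * y)) (𝓝 (-(c * y / 2))) := by
  simp_rw [kern_swap c y]
  rw [← neg_div, ← neg_mul]
  exact tendsto_sub_mul_kern_left hy hσ

variable {c : ℂ} {x : ι → ℂ} {φ₁ φ₀ : Finset ι → ℂ → ℂ}

theorem differentiableAt_extSum {s : Finset ι} {z : ℂ} (h : ∀ i ∈ s, z ^ 2 ≠ x i ^ 2)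
    (h₁ : ∀ I, DifferentiableAt ℂ (φ₁ I) z) (h₀ : ∀ I, DifferentiableAt ℂ (φ₀ I) z) :
    DifferentiableAt ℂ (extSum c x s φ₁ φ₀) z := by
  unfold extSum
  refine DifferentiableAt.fun_sum fun I hI => (differentiableAt_const _).mul
    (((h₁ I).mul ?_).add ((h₀ I).mul ?_))
  · exact differentiableAt_prod_kern_left fun i hi => h i (mem_sdiff.mp hi).1
  · exact differentiableAt_prod_kern_right fun i hi => h i (mem_powerset.mp hI hi)

theorem tendsto_sub_mul_of_continuousAt {f : ℂ → ℂ} {p : ℂ} (h : ContinuousAt f p) :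
    Tendsto (fun z => (z - p) * f z) (𝓝[≠] p) (𝓝 0) := by
  have : ContinuousAt (fun z => (z - p) * f z) p := by fun_prop
  simpa using this.tendsto.mono_left nhdsWithin_le_nhds

theorem tendsto_sub_mul_extSum {s : Finset ι} {b : ι} (hb : b ∉ s) {σ : ℂ} (hσ : σ ^ 2 = 1)
    (hxb : x b ≠ 0) (hx : ∀ i ∈ s, x b ^ 2 ≠ x i ^ 2)
    (h₁ : ∀ I, ContinuousAt (φ₁ I) (σ * x b)) (h₀ : ∀ I, ContinuousAt (φ₀ I) (σ * x b)) :
    Tendsto (fun z => (z - σ * x b) * extSum c x (insert b s) φ₁ φ₀ z) (𝓝[≠] (σ * x b))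
      (𝓝 (c * x b / 2 * ∑ I ∈ s.powerset, wt c x s I *
        ((∏ i ∈ I, kern c (x i) (x b)) * (∏ j ∈ s \ I, kern c (σ * x b) (x j)) * φ₁ I (σ * x b) -
          (∏ j ∈ s \ I, kern c (x b) (x j)) * (∏ i ∈ I, kern c (x i) (σ * x b)) *
            φ₀ (insert b I) (σ * x b)))) := by
  have hx' : ∀ i ∈ s, (σ * x b) ^ 2 ≠ x i ^ 2 := fun i hi => by
    rw [mul_pow, hσ, one_mul]; exact hx i hi
  rw [mul_sum]
  simp_rw [extSum, sum_powerset_insert hb, ← sum_add_distrib, mul_sum]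
  refine tendsto_finsetSum _ fun I hI => ?_
  have hIs := mem_powerset.mp hI
  have hbI : b ∉ I := fun h => hb (hIs h)
  have c₁ : ContinuousAt (fun z => ∏ j ∈ s \ I, kern c z (x j)) (σ * x b) :=
    (differentiableAt_prod_kern_left fun i hi => hx' i (mem_sdiff.mp hi).1).continuousAt
  have c₀ : ContinuousAt (fun z => ∏ i ∈ I, kern c (x i) z) (σ * x b) :=
    (differentiableAt_prod_kern_right fun i hi => hx' i (hIs hi)).continuousAt
  have r₁ := tendsto_sub_mul_of_continuousAt ((h₀ I).mul c₀)
  have r₀ := tendsto_sub_mul_of_continuousAt ((h₁ (insert b I)).mul c₁)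
  have p₁ := (tendsto_sub_mul_kern_left (c := c) hxb hσ).mul
    (((h₁ I).mul c₁).tendsto.mono_left nhdsWithin_le_nhds)
  have p₀ := (tendsto_sub_mul_kern_right (c := c) hxb hσ).mul
    (((h₀ (insert b I)).mul c₀).tendsto.mono_left nhdsWithin_le_nhds)
  have key := ((p₁.add r₁).const_mul (wt c x (insert b s) I)).add
    ((r₀.add p₀).const_mul (wt c x (insert b s) (insert b I)))
  rw [wt_insert_left c x hb hIs, wt_insert_insert c x hb hIs] at *
  rw [insert_sdiff_of_notMem _ hbI, insert_sdiff_insert, sdiff_insert_of_notMem hb]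
  simp_rw [prod_insert hbI, prod_insert (fun h => hb (mem_sdiff.mp h).1 : b ∉ s \ I)]
  convert key using 2
  · simp only [Pi.mul_apply]; ring
  · simp only [Pi.mul_apply]; ring

/-- Vanishing criterion for weighted sums over splittings: as a function of the position of the
particle `a`, the sum has no poles and tends to zero at infinity. -/
theorem sum_powerset_insert_eq_zero (hx0 : ∀ i, x i ≠ 0)
    (hx : ∀ i j, i ≠ j → x i ^ 2 ≠ x j ^ 2) {s : Finset ι} {a : ι} (ha : a ∉ s)
    (φ : Finset ι → ℂ)
    (hφ₁ : ∀ I ⊆ s, φ (insert a I) = φ₁ I (x a)) (hφ₀ : ∀ I ⊆ s, φ I = φ₀ I (x a))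
    (h₁ : ∀ I, ∀ z ≠ 0, DifferentiableAt ℂ (φ₁ I) z)
    (h₀ : ∀ I, ∀ z ≠ 0, DifferentiableAt ℂ (φ₀ I) z)
    (ℓ : Finset ι → ℂ)
    (hℓ₁ : ∀ I, Tendsto (fun z => z * φ₁ I z) (𝓝[≠] 0) (𝓝 (ℓ I)))
    (hℓ₀ : ∀ I, Tendsto (fun z => z * φ₀ I z) (𝓝[≠] 0) (𝓝 (-ℓ I)))
    (hpos : ∀ b ∈ s, ∀ I ⊆ s.erase b, φ₁ I (x b) = φ₀ (insert b I) (x b))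
    (hneg : ∀ b ∈ s,
      (∏ k ∈ s.erase b, kern c (x k) (x b)) *
        ∑ I ∈ (s.erase b).powerset, φ₁ I (-x b) * wt c x (s.erase b) I =
      (∏ k ∈ s.erase b, kern c (x b) (x k)) *
        ∑ I ∈ (s.erase b).powerset, φ₀ (insert b I) (-x b) * wt c x (s.erase b) I)
    (hinf : Tendsto (extSum c x s φ₁ φ₀) (cocompact ℂ) (𝓝 0)) :
    ∑ I ∈ (insert a s).powerset, φ I * wt c x (insert a s) I = 0 := by
  rw [sum_powerset_insert_wt c x ha]
  have e : extSum c x s (fun I _ => φ (insert a I)) (fun I _ => φ I) (x a) =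
      extSum c x s φ₁ φ₀ (x a) := by
    unfold extSum
    refine sum_congr rfl fun I hI => ?_
    simp only [hφ₁ I (mem_powerset.mp hI), hφ₀ I (mem_powerset.mp hI)]
  rw [e]
  have hout : ∀ z, z ∉ insert 0 (s.image x ∪ s.image fun i => -x i) →
      z ≠ 0 ∧ ∀ i ∈ s, z ^ 2 ≠ x i ^ 2 := by
    intro z hz
    simp only [mem_insert, mem_union, mem_image, not_or, not_exists, not_and] at hz
    refine ⟨hz.1, fun i hi h => ?_⟩
    rcases sq_eq_sq_iff_eq_or_eq_neg.mp h with h | h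
    · exact hz.2.1 i hi h.symm
    · exact hz.2.2 i hi h.symm
  refine eq_zero_of_removable_of_tendsto_cocompact
    (insert 0 (s.image x ∪ s.image fun i => -x i)) _ (fun z hz => ?_) (fun p hp => ?_) hinf _ ?_
  · exact differentiableAt_extSum (hout z hz).2 (fun I => h₁ I z (hout z hz).1)
      (fun I => h₀ I z (hout z hz).1)
  · have hb : ∀ b ∈ s, ∀ σ : ℂ, σ ^ 2 = 1 → (σ = 1 ∨ σ = -1) →
        Tendsto (fun z => (z - σ * x b) * extSum c x s φ₁ φ₀ z) (𝓝[≠] (σ * x b)) (𝓝 0) := by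
      intro b hb σ hσ hσ'
      have hσ0 : σ ≠ 0 := by rintro rfl; simp at hσ
      have hne : σ * x b ≠ 0 := mul_ne_zero hσ0 (hx0 b)
      have key := tendsto_sub_mul_extSum (c := c) (x := x) (notMem_erase b s) hσ (hx0 b)
        (fun i hi => hx b i (ne_of_mem_erase hi).symm)
        (fun I => (h₁ I _ hne).continuousAt) (fun I => (h₀ I _ hne).continuousAt)
      rw [insert_erase hb] at key
      convert key using 2
      symm
      refine mul_eq_zero_of_right _ ?_
      rcases hσ' with rfl | rfl
      · refine sum_eq_zero fun I hI => ?_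
        rw [one_mul, hpos b hb I (mem_powerset.mp hI)]
        ring
      · simp_rw [neg_one_mul, kern_neg_left, kern_neg_right]
        have := hneg b hb
        rw [← sub_eq_zero, mul_sum, mul_sum, ← sum_sub_distrib] at this
        rw [← this]
        refine sum_congr rfl fun I hI => ?_
        rw [← prod_sdiff (mem_powerset.mp hI) (f := fun k => kern c (x k) (x b)),
          ← prod_sdiff (mem_powerset.mp hI) (f := fun k => kern c (x b) (x k))]
        ring
    simp only [mem_insert, mem_union, mem_image] at hp
    rcases hp with rfl | ⟨b, hbs, rfl⟩ | ⟨b, hbs, rfl⟩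
    · have : Tendsto (fun z => (z - 0) * extSum c x s φ₁ φ₀ z) (𝓝[≠] 0)
          (𝓝 (∑ I ∈ s.powerset, wt c x s I * (ℓ I * 1 + -ℓ I * 1))) := by
        simp_rw [extSum, mul_sum]
        refine tendsto_finsetSum _ fun I hI => ?_
        have hx0' : ∀ i, 0 ≠ x i ^ 2 := fun i => (pow_ne_zero 2 (hx0 i)).symm
        have k₁ : Tendsto (fun z => ∏ j ∈ s \ I, kern c z (x j)) (𝓝[≠] 0) (𝓝 1) := by
          have := (differentiableAt_prod_kern_left (c := c) (x := x) (I := s \ I) (z := 0)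
            fun i _ => by simpa using hx0' i).continuousAt.tendsto
          simpa [kern] using this.mono_left nhdsWithin_le_nhds
        have k₀ : Tendsto (fun z => ∏ j ∈ I, kern c (x j) z) (𝓝[≠] 0) (𝓝 1) := by
          have := (differentiableAt_prod_kern_right (c := c) (x := x) (I := I) (z := 0)
            fun i _ => by simpa using hx0' i).continuousAt.tendsto
          simpa [kern] using this.mono_left nhdsWithin_le_nhds
        refine ((((hℓ₁ I).mul k₁).add ((hℓ₀ I).mul k₀)).const_mul _).congr fun z => ?_
        ring
      simpa using this
    · simpa using hb b hbs 1 (by norm_num) (Or.inl rfl)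
    · simpa using hb b hbs (-1) (by norm_num) (Or.inr rfl)
  · simp only [mem_insert, mem_union, mem_image, not_or, not_exists, not_and]
    refine ⟨hx0 a, fun b hb h => ?_, fun b hb h => ?_⟩
    · exact hx b a (fun e => ha (e ▸ hb)) (by rw [h])
    · exact hx b a (fun e => ha (e ▸ hb)) (by rw [← h]; ring)

theorem tendsto_mul_prod_kern_right_sub_one (c : ℂ) (x : ι → ℂ) (I : Finset ι) :
    Tendsto (fun z => z * (∏ i ∈ I, kern c (x i) z - 1)) (cocompact ℂ)
      (𝓝 (-c * ∑ i ∈ I, x i)) := by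
  simp_rw [fun z i => kern_swap c (x i) z]
  exact tendsto_mul_prod_kern_sub_one (-c) x I

theorem tendsto_prod_kern_left (c : ℂ) (x : ι → ℂ) (I : Finset ι) :
    Tendsto (fun z => ∏ j ∈ I, kern c z (x j)) (cocompact ℂ) (𝓝 1) :=
  tendsto_of_tendsto_mul_sub_one (tendsto_mul_prod_kern_sub_one c x I)

theorem tendsto_prod_kern_right (c : ℂ) (x : ι → ℂ) (I : Finset ι) :
    Tendsto (fun z => ∏ i ∈ I, kern c (x i) z) (cocompact ℂ) (𝓝 1) :=
  tendsto_of_tendsto_mul_sub_one (tendsto_mul_prod_kern_right_sub_one c x I)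

theorem tendsto_mul_of_continuousAt_zero {f : ℂ → ℂ} (h : ContinuousAt f 0) :
    Tendsto (fun z => z * f z) (𝓝[≠] 0) (𝓝 0) := by
  simpa using tendsto_sub_mul_of_continuousAt h

theorem sum_neg_one_pow_mul_wt (hx0 : ∀ i, x i ≠ 0) (hx : ∀ i j, i ≠ j → x i ^ 2 ≠ x j ^ 2)
    (s : Finset ι) (hs : s.Nonempty) :
    ∑ I ∈ s.powerset, (-1) ^ #I * wt c x s I = 0 := by
  induction s using Finset.strongInduction with | H s ih => ?_
  obtain ⟨a, has⟩ := hs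
  obtain ⟨t, ha, rfl⟩ : ∃ t, a ∉ t ∧ s = insert a t :=
    ⟨s.erase a, notMem_erase a s, (insert_erase has).symm⟩
  refine sum_powerset_insert_eq_zero (φ₁ := fun I _ => -(-1) ^ #I) (φ₀ := fun I _ => (-1) ^ #I)
    hx0 hx ha (fun I => (-1) ^ #I) (fun I hI => ?_) (fun _ _ => rfl) (fun _ _ _ => by fun_prop)
    (fun _ _ _ => by fun_prop) (fun _ => 0)
    (fun _ => tendsto_mul_of_continuousAt_zero (by fun_prop))
    (fun _ => by simpa using tendsto_mul_of_continuousAt_zero (f := fun _ => _) (by fun_prop))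
    (fun b _ I hI => ?_) (fun b hb => ?_) ?_
  · rw [card_insert_of_notMem fun h => ha (hI h)]; ring
  · rw [card_insert_of_notMem fun h => notMem_erase b t (hI h)]; ring
  · have e₀ : ∑ I ∈ (t.erase b).powerset, (-1) ^ #(insert b I) * wt c x (t.erase b) I =
        -∑ I ∈ (t.erase b).powerset, (-1) ^ #I * wt c x (t.erase b) I := by
      rw [← sum_neg_distrib]
      refine sum_congr rfl fun I hI => ?_
      rw [card_insert_of_notMem fun h => notMem_erase b t (mem_powerset.mp hI h)]; ring
    simp_rw [neg_mul, sum_neg_distrib]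
    rw [e₀]
    rcases (t.erase b).eq_empty_or_nonempty with h | h
    · simp [h]
    · rw [ih _ ((erase_subset b t).trans_ssubset (ssubset_insert ha)) h]; simp
  · have key : Tendsto (extSum c x t (fun I _ => -(-1) ^ #I) (fun I _ => (-1) ^ #I)) (cocompact ℂ)
        (𝓝 (∑ I ∈ t.powerset, wt c x t I * (-(-1) ^ #I * 1 + (-1) ^ #I * 1))) :=
      tendsto_finsetSum _ fun I _ => (((tendsto_prod_kern_left c x _).const_mul _).add
        ((tendsto_prod_kern_right c x _).const_mul _)).const_mul _
    simpa using key

theorem sum_neg_one_pow_mul_card_mul_wt (hx0 : ∀ i, x i ≠ 0)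
    (hx : ∀ i j, i ≠ j → x i ^ 2 ≠ x j ^ 2) (s : Finset ι) (hs : Even #s) :
    ∑ I ∈ s.powerset, (-1) ^ #I * (#I : ℂ) * wt c x s I = 0 := by
  induction s using Finset.strongInduction with | H s ih => ?_
  rcases s.eq_empty_or_nonempty with rfl | ⟨a, has⟩
  · simp
  obtain ⟨t, ha, rfl⟩ : ∃ t, a ∉ t ∧ s = insert a t :=
    ⟨s.erase a, notMem_erase a s, (insert_erase has).symm⟩
  have ht : Odd #t := by
    rw [card_insert_of_notMem ha] at hs
    exact Nat.not_even_iff_odd.mp (Nat.even_add_one.mp hs)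
  refine sum_powerset_insert_eq_zero (φ₁ := fun I _ => -(-1) ^ #I * (#I + 1))
    (φ₀ := fun I _ => (-1) ^ #I * #I)
    hx0 hx ha (fun I => (-1) ^ #I * #I) (fun I hI => ?_) (fun _ _ => rfl)
    (fun _ _ _ => by fun_prop) (fun _ _ _ => by fun_prop) (fun _ => 0)
    (fun _ => tendsto_mul_of_continuousAt_zero (by fun_prop))
    (fun _ => by simpa using tendsto_mul_of_continuousAt_zero (f := fun _ => _) (by fun_prop))
    (fun b _ I hI => ?_) (fun b hb => ?_) ?_
  · rw [card_insert_of_notMem fun h => ha (hI h)]; push_cast; ring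
  · rw [card_insert_of_notMem fun h => notMem_erase b t (hI h)]; push_cast; ring
  · have e₁ : ∑ I ∈ (t.erase b).powerset, -(-1) ^ #I * ((#I : ℂ) + 1) * wt c x (t.erase b) I =
        -∑ I ∈ (t.erase b).powerset, (-1) ^ #I * (#I : ℂ) * wt c x (t.erase b) I -
          ∑ I ∈ (t.erase b).powerset, (-1) ^ #I * wt c x (t.erase b) I := by
      rw [← sum_neg_distrib, ← sum_sub_distrib]
      exact sum_congr rfl fun I _ => by ring
    have e₀ : ∑ I ∈ (t.erase b).powerset,
        (-1) ^ #(insert b I) * (#(insert b I) : ℂ) * wt c x (t.erase b) I =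
        ∑ I ∈ (t.erase b).powerset, -(-1) ^ #I * ((#I : ℂ) + 1) * wt c x (t.erase b) I := by
      refine sum_congr rfl fun I hI => ?_
      rw [card_insert_of_notMem fun h => notMem_erase b t (mem_powerset.mp hI h)]; push_cast; ring
    rw [e₀, e₁]
    rcases (t.erase b).eq_empty_or_nonempty with h | h
    · simp [h]
    · rw [ih _ ((erase_subset b t).trans_ssubset (ssubset_insert ha))
        (by rw [card_erase_of_mem hb]; exact Nat.Odd.sub_odd ht odd_one),
        sum_neg_one_pow_mul_wt hx0 hx _ h]
      simp
  · have key : Tendsto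
        (extSum c x t (fun I _ => -(-1) ^ #I * (#I + 1)) (fun I _ => (-1) ^ #I * #I)) (cocompact ℂ)
        (𝓝 (∑ I ∈ t.powerset,
          wt c x t I * (-(-1) ^ #I * (#I + 1) * 1 + (-1) ^ #I * #I * 1))) :=
      tendsto_finsetSum _ fun I _ => (((tendsto_prod_kern_left c x _).const_mul _).add
        ((tendsto_prod_kern_right c x _).const_mul _)).const_mul _
    convert key using 2
    rw [← neg_zero, ← sum_neg_one_pow_mul_wt hx0 hx t (card_pos.mp ht.pos), ← sum_neg_distrib]
    exact sum_congr rfl fun I _ => by ring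

theorem sum_neg_one_pow_mul_sum_sub_mul_wt (hx0 : ∀ i, x i ≠ 0)
    (hx : ∀ i j, i ≠ j → x i ^ 2 ≠ x j ^ 2) (s : Finset ι) (hs : Odd #s) :
    ∑ I ∈ s.powerset, (-1) ^ #I * (∑ i ∈ I, x i - #I * ∑ i ∈ s, x i) * wt c x s I = 0 := by
  induction s using Finset.strongInduction with | H s ih => ?_
  obtain ⟨a, has⟩ := card_pos.mp hs.pos
  obtain ⟨t, ha, rfl⟩ : ∃ t, a ∉ t ∧ s = insert a t :=
    ⟨s.erase a, notMem_erase a s, (insert_erase has).symm⟩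
  have ht : Even #t := by
    rw [card_insert_of_notMem ha] at hs
    exact Nat.not_odd_iff_even.mp (Nat.odd_add_one.mp hs)
  rcases t.eq_empty_or_nonempty with rfl | htne
  · rw [sum_powerset_insert (notMem_empty a)]; simp
  refine sum_powerset_insert_eq_zero
    (φ₁ := fun I z => -(-1) ^ #I * (z + ∑ i ∈ I, x i - (#I + 1) * (z + ∑ i ∈ t, x i)))
    (φ₀ := fun I z => (-1) ^ #I * (∑ i ∈ I, x i - #I * (z + ∑ i ∈ t, x i)))
    hx0 hx ha _ (fun I hI => ?_) (fun I hI => ?_)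
    (fun _ _ _ => by fun_prop) (fun _ _ _ => by fun_prop) (fun _ => 0)
    (fun _ => tendsto_mul_of_continuousAt_zero (by fun_prop))
    (fun _ => by
      rw [neg_zero]; exact tendsto_mul_of_continuousAt_zero (by fun_prop))
    (fun b _ I hI => ?_) (fun b hb => ?_) ?_
  · have haI : a ∉ I := fun h => ha (hI h)
    rw [card_insert_of_notMem haI, sum_insert haI, sum_insert ha]; push_cast; ring
  · rw [sum_insert ha]
  · have hbI : b ∉ I := fun h => notMem_erase b t (hI h)
    rw [card_insert_of_notMem hbI, sum_insert hbI]; push_cast; ring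
  · have hne : (t.erase b).Nonempty := card_pos.mp (by
      rw [card_erase_of_mem hb]
      have := card_pos.mpr htne
      obtain ⟨k, hk⟩ := ht
      omega)
    have hA := sum_neg_one_pow_mul_wt (c := c) hx0 hx _ hne
    have hV := ih _ ((erase_subset b t).trans_ssubset (ssubset_insert ha))
      (by rw [card_erase_of_mem hb]; exact Nat.Even.sub_odd (card_pos.mpr htne) ht odd_one)
    rw [← add_sum_erase t x hb]
    set R := ∑ i ∈ t.erase b, x i
    have e₁ : ∑ I ∈ (t.erase b).powerset, -(-1) ^ #I *
        (-x b + ∑ i ∈ I, x i - (#I + 1) * (-x b + (x b + R))) * wt c x (t.erase b) I =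
        -∑ I ∈ (t.erase b).powerset, (-1) ^ #I * (∑ i ∈ I, x i - #I * R) * wt c x (t.erase b) I +
          (x b + R) * ∑ I ∈ (t.erase b).powerset, (-1) ^ #I * wt c x (t.erase b) I := by
      rw [← sum_neg_distrib, mul_sum (t.erase b).powerset, ← sum_add_distrib]
      exact sum_congr rfl fun I _ => by ring
    have e₀ : ∑ I ∈ (t.erase b).powerset, (-1) ^ #(insert b I) *
        (∑ i ∈ insert b I, x i - #(insert b I) * (-x b + (x b + R))) * wt c x (t.erase b) I =
        -∑ I ∈ (t.erase b).powerset, (-1) ^ #I * (∑ i ∈ I, x i - #I * R) * wt c x (t.erase b) I +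
          (R - x b) * ∑ I ∈ (t.erase b).powerset, (-1) ^ #I * wt c x (t.erase b) I := by
      rw [← sum_neg_distrib, mul_sum (t.erase b).powerset, ← sum_add_distrib]
      refine sum_congr rfl fun I hI => ?_
      have hbI : b ∉ I := fun h => notMem_erase b t (mem_powerset.mp hI h)
      rw [card_insert_of_notMem hbI, sum_insert hbI]; push_cast; ring
    rw [e₁, e₀, hA, hV]; simp
  · set R := ∑ i ∈ t, x i with hR
    have key : Tendsto (fun z => ∑ I ∈ t.powerset, wt c x t I * ((-1) ^ #I *
          (#I * (z * (∏ j ∈ t \ I, kern c z (x j) - 1) - z * (∏ i ∈ I, kern c (x i) z - 1)) -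
            (∑ i ∈ I, x i - (#I + 1) * R) * ∏ j ∈ t \ I, kern c z (x j) +
            (∑ i ∈ I, x i - #I * R) * ∏ i ∈ I, kern c (x i) z))) (cocompact ℂ)
        (𝓝 (∑ I ∈ t.powerset, wt c x t I * ((-1) ^ #I *
          (#I * (c * ∑ j ∈ t \ I, x j - -c * ∑ i ∈ I, x i) -
            (∑ i ∈ I, x i - (#I + 1) * R) * 1 + (∑ i ∈ I, x i - #I * R) * 1)))) :=
      tendsto_finsetSum _ fun I _ => (((((tendsto_mul_prod_kern_sub_one c x _).sub
        (tendsto_mul_prod_kern_right_sub_one c x _)).const_mul _).sub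
        ((tendsto_prod_kern_left c x _).const_mul _)).add
        ((tendsto_prod_kern_right c x _).const_mul _)).const_mul _ |>.const_mul _
    have e : ∑ I ∈ t.powerset, wt c x t I * ((-1) ^ #I *
          (#I * (c * ∑ j ∈ t \ I, x j - -c * ∑ i ∈ I, x i) -
            (∑ i ∈ I, x i - (#I + 1) * R) * 1 + (∑ i ∈ I, x i - #I * R) * 1)) = 0 := by
      have : ∑ I ∈ t.powerset, wt c x t I * ((-1) ^ #I *
          (#I * (c * ∑ j ∈ t \ I, x j - -c * ∑ i ∈ I, x i) -
            (∑ i ∈ I, x i - (#I + 1) * R) * 1 + (∑ i ∈ I, x i - #I * R) * 1)) =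
          c * R * ∑ I ∈ t.powerset, (-1) ^ #I * (#I : ℂ) * wt c x t I +
            R * ∑ I ∈ t.powerset, (-1) ^ #I * wt c x t I := by
        rw [mul_sum t.powerset, mul_sum t.powerset, ← sum_add_distrib]
        refine sum_congr rfl fun I hI => ?_
        rw [hR, ← sum_sdiff (mem_powerset.mp hI)]; ring
      rw [this, sum_neg_one_pow_mul_wt hx0 hx t htne,
        sum_neg_one_pow_mul_card_mul_wt hx0 hx t ht]
      simp
    rw [e] at key
    refine key.congr fun z => sum_congr rfl fun I _ => ?_
    ring

theorem sum_inv_mul_sum_add_mul_wt {ω : ℂ} (hω : ω ≠ 0) (hc : c = ω - ω⁻¹) (hx0 : ∀ i, x i ≠ 0)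
    (hx : ∀ i j, i ≠ j → x i ^ 2 ≠ x j ^ 2) (s : Finset ι) (hs : s.Nonempty) :
    ∑ I ∈ s.powerset, (c * (∑ i ∈ s, (x i)⁻¹) * ((-1) ^ #I * ∑ i ∈ I, x i) +
      (-ω⁻¹) ^ #s * (-ω ^ 2) ^ #I) * wt c x s I = 0 := by
  have hq : (-ω⁻¹) ^ 2 * ω ^ 2 = 1 := by field_simp
  induction s using Finset.strongInduction with | H s ih => ?_
  obtain ⟨a, has⟩ := hs
  obtain ⟨t, ha, rfl⟩ : ∃ t, a ∉ t ∧ s = insert a t :=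
    ⟨s.erase a, notMem_erase a s, (insert_erase has).symm⟩
  rcases t.eq_empty_or_nonempty with rfl | htne
  · rw [sum_powerset_insert (notMem_empty a)]
    have := hx0 a
    simp [wt, hc]
    field_simp
    ring
  set R := ∑ i ∈ t, (x i)⁻¹ with hR
  refine sum_powerset_insert_eq_zero
    (φ₁ := fun I z => c * (z⁻¹ + R) * (-(-1) ^ #I * (z + ∑ i ∈ I, x i)) +
      (-ω⁻¹) ^ (#t + 1) * (-ω ^ 2) ^ (#I + 1))
    (φ₀ := fun I z => c * (z⁻¹ + R) * ((-1) ^ #I * ∑ i ∈ I, x i) +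
      (-ω⁻¹) ^ (#t + 1) * (-ω ^ 2) ^ #I)
    hx0 hx ha _ (fun I hI => ?_) (fun I hI => ?_)
    (fun _ _ hz => by fun_prop (disch := exact hz)) (fun _ _ hz => by fun_prop (disch := exact hz))
    (fun I => -(c * (-1) ^ #I * ∑ i ∈ I, x i)) (fun I => ?_) (fun I => ?_)
    (fun b _ I hI => ?_) (fun b hb => ?_) ?_
  · have haI : a ∉ I := fun h => ha (hI h)
    rw [card_insert_of_notMem haI, card_insert_of_notMem ha, sum_insert haI, sum_insert ha]; ring
  · rw [sum_insert ha, card_insert_of_notMem ha]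
  · have h : ContinuousAt (fun z : ℂ => c * (1 + z * R) * (-(-1) ^ #I * (z + ∑ i ∈ I, x i)) +
      z * ((-ω⁻¹) ^ (#t + 1) * (-ω ^ 2) ^ (#I + 1))) 0 := by fun_prop
    convert (h.tendsto.mono_left nhdsWithin_le_nhds).congr' ?_ using 2
    · ring
    · filter_upwards [self_mem_nhdsWithin] with z hz
      have hz : z ≠ 0 := hz
      field_simp
  · have h : ContinuousAt (fun z : ℂ => c * (1 + z * R) * ((-1) ^ #I * ∑ i ∈ I, x i) +
      z * ((-ω⁻¹) ^ (#t + 1) * (-ω ^ 2) ^ #I)) 0 := by fun_prop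
    convert (h.tendsto.mono_left nhdsWithin_le_nhds).congr' ?_ using 2
    · ring
    · filter_upwards [self_mem_nhdsWithin] with z hz
      have hz : z ≠ 0 := hz
      field_simp
  · have hbI : b ∉ I := fun h => notMem_erase b t (hI h)
    rw [card_insert_of_notMem hbI, sum_insert hbI]; ring
  · have hR' : (-x b)⁻¹ + R = ∑ i ∈ t.erase b, (x i)⁻¹ := by
      rw [hR, ← add_sum_erase t _ hb, inv_neg]; ring
    simp only [hR']
    have hcard : #t = #(t.erase b) + 1 := (card_erase_add_one hb).symm
    rw [hcard]
    set Q := ∑ i ∈ t.erase b, (x i)⁻¹ with hQ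
    set m := #(t.erase b) with hm
    have e₁ : ∑ I ∈ (t.erase b).powerset, (c * Q * (-(-1) ^ #I * (-x b + ∑ i ∈ I, x i)) +
        (-ω⁻¹) ^ (m + 1 + 1) * (-ω ^ 2) ^ (#I + 1)) * wt c x (t.erase b) I =
        -∑ I ∈ (t.erase b).powerset, (c * Q * ((-1) ^ #I * ∑ i ∈ I, x i) +
          (-ω⁻¹) ^ m * (-ω ^ 2) ^ #I) * wt c x (t.erase b) I +
        c * Q * x b * ∑ I ∈ (t.erase b).powerset, (-1) ^ #I * wt c x (t.erase b) I := by
      rw [← sum_neg_distrib, mul_sum (t.erase b).powerset, ← sum_add_distrib]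
      refine sum_congr rfl fun I _ => ?_
      linear_combination (-(-ω⁻¹) ^ m * (-ω ^ 2) ^ #I * wt c x (t.erase b) I) * hq
    have e₀ : ∑ I ∈ (t.erase b).powerset, (c * Q * ((-1) ^ #(insert b I) * ∑ i ∈ insert b I, x i) +
        (-ω⁻¹) ^ (m + 1 + 1) * (-ω ^ 2) ^ #(insert b I)) * wt c x (t.erase b) I =
        -∑ I ∈ (t.erase b).powerset, (c * Q * ((-1) ^ #I * ∑ i ∈ I, x i) +
          (-ω⁻¹) ^ m * (-ω ^ 2) ^ #I) * wt c x (t.erase b) I -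
        c * Q * x b * ∑ I ∈ (t.erase b).powerset, (-1) ^ #I * wt c x (t.erase b) I := by
      rw [← sum_neg_distrib, mul_sum (t.erase b).powerset, ← sum_sub_distrib]
      refine sum_congr rfl fun I hI => ?_
      have hbI : b ∉ I := fun h => notMem_erase b t (mem_powerset.mp hI h)
      rw [card_insert_of_notMem hbI, sum_insert hbI]
      linear_combination (-(-ω⁻¹) ^ m * (-ω ^ 2) ^ #I * wt c x (t.erase b) I) * hq
    rw [e₁, e₀]
    rcases (t.erase b).eq_empty_or_nonempty with h | h
    · have hQ0 : Q = 0 := by rw [hQ, h, sum_empty]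
      simp [h, hQ0]
    · rw [ih _ ((erase_subset b t).trans_ssubset (ssubset_insert ha)) h,
        sum_neg_one_pow_mul_wt hx0 hx _ h]
      simp
  · have hA := sum_neg_one_pow_mul_wt (c := c) hx0 hx t htne
    have hU := ih t (ssubset_insert ha) htne
    have key : Tendsto (fun z => ∑ I ∈ t.powerset, wt c x t I *
        (c * (z⁻¹ + R) * ((-1) ^ #I * ((∑ i ∈ I, x i) *
            ((∏ i ∈ I, kern c (x i) z) - ∏ j ∈ t \ I, kern c z (x j)) -
            z * (∏ j ∈ t \ I, kern c z (x j) - 1))) +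
          (-ω⁻¹) ^ (#t + 1) * (-ω ^ 2) ^ #I *
            (-ω ^ 2 * (∏ j ∈ t \ I, kern c z (x j)) + ∏ i ∈ I, kern c (x i) z))) (cocompact ℂ)
        (𝓝 (∑ I ∈ t.powerset, wt c x t I *
        (c * (0 + R) * ((-1) ^ #I * ((∑ i ∈ I, x i) * (1 - 1) - c * ∑ j ∈ t \ I, x j)) +
          (-ω⁻¹) ^ (#t + 1) * (-ω ^ 2) ^ #I * (-ω ^ 2 * 1 + 1)))) := by
      refine tendsto_finsetSum _ fun I _ => Tendsto.const_mul _ ?_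
      have k₁ := tendsto_prod_kern_left c x (t \ I)
      have k₀ := tendsto_prod_kern_right c x I
      exact (((tendsto_inv_cocompact_complex.add_const R).const_mul c).mul ((((k₀.sub k₁).const_mul _).sub
        (tendsto_mul_prod_kern_sub_one c x _)).const_mul _)).add
        (((k₁.const_mul _).add k₀).const_mul _)
    have e : ∑ I ∈ t.powerset, wt c x t I *
        (c * (0 + R) * ((-1) ^ #I * ((∑ i ∈ I, x i) * (1 - 1) - c * ∑ j ∈ t \ I, x j)) +
          (-ω⁻¹) ^ (#t + 1) * (-ω ^ 2) ^ #I * (-ω ^ 2 * 1 + 1)) = 0 := by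
      have : ∑ I ∈ t.powerset, wt c x t I *
          (c * (0 + R) * ((-1) ^ #I * ((∑ i ∈ I, x i) * (1 - 1) - c * ∑ j ∈ t \ I, x j)) +
          (-ω⁻¹) ^ (#t + 1) * (-ω ^ 2) ^ #I * (-ω ^ 2 * 1 + 1)) =
          c * ∑ I ∈ t.powerset, (c * R * ((-1) ^ #I * ∑ i ∈ I, x i) +
            (-ω⁻¹) ^ #t * (-ω ^ 2) ^ #I) * wt c x t I -
          c ^ 2 * R * (∑ i ∈ t, x i) * ∑ I ∈ t.powerset, (-1) ^ #I * wt c x t I := by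
        rw [mul_sum t.powerset, mul_sum t.powerset, ← sum_sub_distrib]
        refine sum_congr rfl fun I hI => ?_
        have hcq : -ω⁻¹ * (-ω ^ 2 + 1) = c := by rw [hc]; field_simp; ring
        rw [← sum_sdiff (mem_powerset.mp hI) (f := x)]
        linear_combination ((-ω⁻¹) ^ #t * (-ω ^ 2) ^ #I * wt c x t I) * hcq
      rw [this, hU, hA]; simp
    rw [e] at key
    refine key.congr' ?_
    filter_upwards [(isCompact_singleton (x := (0 : ℂ))).compl_mem_cocompact] with z hz
    have hz : z ≠ 0 := hz
    rw [← sub_eq_zero, extSum, ← sum_sub_distrib]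
    have : c * (z⁻¹ + R) * z * ∑ I ∈ t.powerset, (-1) ^ #I * wt c x t I = 0 := by rw [hA, mul_zero]
    rw [← this, mul_sum]
    refine sum_congr rfl fun I _ => ?_
    ring

end

theorem ff_div_eq_kern {ω x y : ℂ} (hω : ω ≠ 0) (hy : y ≠ 0) (hxy : x ^ 2 ≠ y ^ 2) :
    ff ω (x / y) = kern (ω - ω⁻¹) x y := by
  have h : x ^ 2 - y ^ 2 ≠ 0 := sub_ne_zero.mpr hxy
  have h' : (x / y) ^ 2 - 1 = (x ^ 2 - y ^ 2) / y ^ 2 := by field_simp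
  rw [ff, kern, h']
  field_simp
  ring

theorem phase_neg_half (N k : ℕ) : phase (-(1 / 2)) N k = I ^ N * (-1) ^ k := by
  have h : I * (Real.pi : ℂ) * (-(1 / 2)) * (2 * (k : ℂ) - N) =
      N * (Real.pi / 2 * I) + k * -(Real.pi * I) := by ring
  rw [phase, h, exp_add, exp_nat_mul, exp_nat_mul, exp_pi_div_two_mul_I, exp_neg, exp_pi_mul_I,
    inv_neg_one]

theorem hasDerivAt_phase (a : ℂ) (N k : ℕ) :
    HasDerivAt (fun a => phase a N k) (phase a N k * (I * Real.pi * (2 * k - N))) a := by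
  unfold phase
  refine HasDerivAt.cexp ?_
  simpa using ((hasDerivAt_id a).const_mul (I * (Real.pi : ℂ))).mul_const (2 * (k : ℂ) - N)

/-- consistency with the sine-Gordon equation of motion: for odd `N` and
admissible `X`,
`S_1(X)·S_{−1}(X)·(d/da J_{N,a}(X))|_{a=−1/2} = (π/sin πp)·J̃_N(X)`,
with `sin πp = (ω − ω⁻¹)/(2i)`. -/
theorem stmt15 (ω : ℂ) (hω : ω ≠ 0 ∧ ω ≠ 1 ∧ ω ≠ -1)
    (N : ℕ) (hN : Odd N) (X : Fin N → ℂ) (hadm : Admissible X) :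
    (∑ i : Fin N, X i) * (∑ i : Fin N, (X i)⁻¹) *
      deriv (fun a : ℂ => Jexp ω a X) (-(1 / 2 : ℂ))
    = ((Real.pi : ℂ) / ((ω - ω⁻¹) / (2 * Complex.I))) * Jtilde ω X := by
  have hω0 := hω.1
  obtain ⟨hx0, hadm'⟩ := hadm
  have hx : ∀ i j, i ≠ j → X i ^ 2 ≠ X j ^ 2 := fun i j hij h =>
    (sq_eq_sq_iff_eq_or_eq_neg.mp h).elim (hadm' i j hij).1 (hadm' i j hij).2
  have hc0 : ω - ω⁻¹ ≠ 0 := by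
    intro h
    have h1 : ω * ω = 1 := by
      rw [sub_eq_zero] at h
      nth_rewrite 2 [h]
      exact mul_inv_cancel₀ hω0
    rcases mul_self_eq_one_iff.mp h1 with h | h
    exacts [hω.2.1 h, hω.2.2 h]
  have hw : ∀ J : Finset (Fin N), ∏ i ∈ J, ∏ j ∈ Jᶜ, ff ω (X i / X j) =
      wt (ω - ω⁻¹) X univ J := fun J => by
    rw [wt, compl_eq_univ_sdiff]
    refine prod_congr rfl fun i hi => prod_congr rfl fun j hj => ff_div_eq_kern hω0 (hx0 j) ?_
    exact hx i j fun h => (mem_sdiff.mp hj).2 (h ▸ hi)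
  have hne : (univ : Finset (Fin N)).Nonempty := card_pos.mp (by simpa using hN.pos)
  have hA := sum_neg_one_pow_mul_wt (c := ω - ω⁻¹) hx0 hx univ hne
  have hV := sum_neg_one_pow_mul_sum_sub_mul_wt (c := ω - ω⁻¹) hx0 hx univ (by simpa using hN)
  have hU := sum_inv_mul_sum_add_mul_wt hω0 rfl hx0 hx univ hne
  rw [powerset_univ] at hA hV hU
  rw [card_univ, Fintype.card_fin] at hU
  simp only [Jexp, Jtilde, hw]
  set c := ω - ω⁻¹
  have hderiv : HasDerivAt (fun a : ℂ => ∑ J : Finset (Fin N), phase a N #J * wt c X univ J)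
      (∑ J : Finset (Fin N),
        phase (-(1 / 2)) N #J * (I * Real.pi * (2 * #J - N)) * wt c X univ J) (-(1 / 2)) :=
    HasDerivAt.fun_sum fun J _ => (hasDerivAt_phase _ N #J).mul_const _
  rw [hderiv.deriv]
  have hD : ∑ J : Finset (Fin N),
      phase (-(1 / 2)) N #J * (I * Real.pi * (2 * #J - N)) * wt c X univ J =
      I ^ N * I * Real.pi * 2 * (∑ J : Finset (Fin N), (-1) ^ #J * (#J : ℂ) * wt c X univ J) := by
    have : ∑ J : Finset (Fin N),
        phase (-(1 / 2)) N #J * (I * Real.pi * (2 * #J - N)) * wt c X univ J =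
        I ^ N * I * Real.pi * 2 * (∑ J : Finset (Fin N), (-1) ^ #J * (#J : ℂ) * wt c X univ J) -
          I ^ N * I * Real.pi * N * ∑ J : Finset (Fin N), (-1) ^ #J * wt c X univ J := by
      rw [mul_sum, mul_sum, ← sum_sub_distrib]
      refine sum_congr rfl fun J _ => ?_
      rw [phase_neg_half]; ring
    rw [this, hA]; ring
  have hT : ∑ J : Finset (Fin N), (-(I * ω)) ^ (2 * (#J : ℤ) - (N : ℤ)) * wt c X univ J =
      I ^ N * ω⁻¹ ^ N * ∑ J : Finset (Fin N), (-ω ^ 2) ^ #J * wt c X univ J := by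
    rw [mul_sum]
    refine sum_congr rfl fun J _ => ?_
    have hb : -(I * ω) ≠ 0 := neg_ne_zero.mpr (mul_ne_zero I_ne_zero hω0)
    have h2 : (-(I * ω)) ^ 2 = -ω ^ 2 := by rw [neg_sq, mul_pow, I_sq]; ring
    have hi : (-(I * ω))⁻¹ = I * ω⁻¹ := by rw [inv_neg, mul_inv, inv_I]; ring
    rw [zpow_sub₀ hb, zpow_mul, zpow_natCast, zpow_natCast, zpow_ofNat, h2, div_eq_mul_inv,
      ← inv_pow, hi, mul_pow]
    ring
  have hV' : ∑ J : Finset (Fin N), (-1) ^ #J * (∑ i ∈ J, X i) * wt c X univ J =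
      (∑ i, X i) * ∑ J : Finset (Fin N), (-1) ^ #J * (#J : ℂ) * wt c X univ J := by
    rw [← sub_eq_zero, ← hV, mul_sum (univ : Finset (Finset (Fin N))), ← sum_sub_distrib]
    exact sum_congr rfl fun J _ => by ring
  have hU' : c * (∑ i, (X i)⁻¹) *
      (∑ J : Finset (Fin N), (-1) ^ #J * (∑ i ∈ J, X i) * wt c X univ J) =
      ω⁻¹ ^ N * ∑ J : Finset (Fin N), (-ω ^ 2) ^ #J * wt c X univ J := by
    rw [← sub_eq_zero, ← hU, mul_sum (univ : Finset (Finset (Fin N))),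
      mul_sum (univ : Finset (Finset (Fin N))), ← sum_sub_distrib]
    refine sum_congr rfl fun J _ => ?_
    rw [hN.neg_pow]; ring
  rw [hV'] at hU'
  rw [hD, hT, mul_assoc (I ^ N) (ω⁻¹ ^ N), ← hU']
  field_simp
end

section
/- Cluster factorization property: let h be a partition of weight n with multiplicities (k_1,…,k_s), let h̄' be a partition with multiplicities (k̄_1,…,k̄_t), and let g denote the pair with associated function P^g = P^h · P^{h̄'}. For every a ∈ ℂ, 0 ≤ l ≤ N, and admissible tuples (x_1,…,x_l) and (x_{l+1},…,x_N) (all entries nonzero), one has lim_{Λ→+∞} e^{−nΛ} · J^g_{N,a}(e^Λ x_1, …, e^Λ x_l, x_{l+1}, …, x_N) = J^h_{l,a}(x_1,…,x_l) · J^{h̄'}_{N−l,a}(x_{l+1},…,x_N), where Λ ranges over real numbers (for all sufficiently large Λ the combined tuple is admissible). Since J^h_{l,a} is homogeneous of degree n, this is the cluster factorization f^{h h̄'}_a(θ_1,…,θ_l, θ_{l+1}+Λ,…,θ_N+Λ) ≃ f^h_a(θ_{l+1}+Λ,…,θ_N+Λ) · f^{h̄'}_a(θ_1,…,θ_l). 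-/
open Finset Filter Complex

/-- The antichiral polynomial
`P^{h̄'}(X_-|X_+) = ∏_{m=1}^t (S_{−m}(X_+) − (−1)^m S_{−m}(X_-))^{k̄_m}`. -/
noncomputable def Pbar (kb : ℕ → ℕ) (t : ℕ) {N : ℕ} (X : Fin N → ℂ)
    (Im Ip : Finset (Fin N)) : ℂ :=
  ∏ m ∈ Finset.Icc 1 t,
    (pS (-(m : ℤ)) X Ip - (-1 : ℂ) ^ m * pS (-(m : ℤ)) X Im) ^ kb m

/-- The `J` function of the pair `g = (h, h̄')`, with `P^g = P^h · P^{h̄'}`. -/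
noncomputable def Jg (ω : ℂ) (k : ℕ → ℕ) (s : ℕ) (kb : ℕ → ℕ) (t : ℕ) (a : ℂ)
    {N : ℕ} (X : Fin N → ℂ) : ℂ :=
  ∑ I : Finset (Fin N),
    phase a N I.card * (Ph k s X I Iᶜ * Pbar kb t X I Iᶜ) *
      ∏ i ∈ I, ∏ j ∈ Iᶜ, ff ω (X i / X j)

/-- The `J` function of the antichiral partition `h̄'` alone. -/
noncomputable def Jbar (ω : ℂ) (kb : ℕ → ℕ) (t : ℕ) (a : ℂ) {N : ℕ} (X : Fin N → ℂ) : ℂ :=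
  ∑ I : Finset (Fin N),
    phase a N I.card * Pbar kb t X I Iᶜ * ∏ i ∈ I, ∏ j ∈ Iᶜ, ff ω (X i / X j)

/-- The subset of `Fin (l + M)` with traces `A` and `B` on the first `l` and last `M` indices. -/
def appendSet {l M : ℕ} (A : Finset (Fin l)) (B : Finset (Fin M)) : Finset (Fin (l + M)) :=
  (A.disjSum B).map finSumFinEquiv.toEmbedding

lemma card_appendSet {l M : ℕ} (A : Finset (Fin l)) (B : Finset (Fin M)) :
    (appendSet A B).card = A.card + B.card := by
  simp [appendSet]

lemma compl_appendSet {l M : ℕ} (A : Finset (Fin l)) (B : Finset (Fin M)) :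
    (appendSet A B)ᶜ = appendSet Aᶜ Bᶜ := by
  ext x
  obtain ⟨y, rfl⟩ := finSumFinEquiv.surjective x
  cases y <;> simp [appendSet, -finSumFinEquiv_apply_left, -finSumFinEquiv_apply_right]

lemma prod_appendSet {l M : ℕ} (A : Finset (Fin l)) (B : Finset (Fin M))
    (g : Fin (l + M) → ℂ) :
    ∏ i ∈ appendSet A B, g i = (∏ i ∈ A, g (Fin.castAdd M i)) * ∏ i ∈ B, g (Fin.natAdd l i) := by
  simp [appendSet, Finset.prod_disjSum]

lemma pS_append {l M : ℕ} (m : ℤ) (X : Fin l → ℂ) (Y : Fin M → ℂ) (A : Finset (Fin l))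
    (B : Finset (Fin M)) :
    pS m (Fin.append X Y) (appendSet A B) = pS m X A + pS m Y B := by
  simp [pS, appendSet, Finset.sum_disjSum]

lemma pS_const_mul {l : ℕ} (m : ℤ) (c : ℂ) (X : Fin l → ℂ) (A : Finset (Fin l)) :
    pS m (fun i => c * X i) A = c ^ m * pS m X A := by
  simp [pS, mul_zpow, Finset.mul_sum]

lemma sum_finset_append {l M : ℕ} (F : Finset (Fin (l + M)) → ℂ) :
    ∑ I, F I = ∑ A : Finset (Fin l), ∑ B : Finset (Fin M), F (appendSet A B) := by
  rw [← Fintype.sum_prod_type']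
  symm
  exact Fintype.sum_equiv
    (Finset.sumEquiv.symm.toEquiv.trans finSumFinEquiv.finsetCongr) _ _ fun _ => rfl

lemma phase_add (a : ℂ) (l M c d : ℕ) :
    phase a (l + M) (c + d) = phase a l c * phase a M d := by
  simp only [phase, ← Complex.exp_add]
  push_cast
  ring_nf

lemma tendsto_ff_zero {ω : ℂ} (hω : ω ≠ 0) {α : Type*} {F : Filter α} {u : α → ℂ}
    (hu : Tendsto u F (nhds 0)) : Tendsto (fun x => ff ω (u x)) F (nhds 1) := by
  have h : Tendsto (fun x => ff ω (u x)) F (nhds ((0 + ω) * (0 - ω⁻¹) / (0 ^ 2 - 1))) :=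
    ((hu.add_const ω).mul (hu.sub_const ω⁻¹)).div ((hu.pow 2).sub_const 1) (by norm_num)
  convert h using 2
  field_simp
  norm_num

lemma tendsto_ff_of_inv {ω : ℂ} {α : Type*} {F : Filter α} {u : α → ℂ}
    (hne : ∀ x, u x ≠ 0) (hu : Tendsto (fun x => (u x)⁻¹) F (nhds 0)) :
    Tendsto (fun x => ff ω (u x)) F (nhds 1) := by
  have h : Tendsto (fun x => (1 + ω * (u x)⁻¹) * (1 - ω⁻¹ * (u x)⁻¹) / (1 - (u x)⁻¹ ^ 2)) F
      (nhds ((1 + ω * 0) * (1 - ω⁻¹ * 0) / (1 - 0 ^ 2))) :=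
    (((hu.const_mul ω).const_add 1).mul ((hu.const_mul ω⁻¹).const_sub 1)).div
      ((hu.pow 2).const_sub 1) (by norm_num)
  convert h using 2 with x
  · have hx := hne x
    rw [ff, ← mul_div_mul_left _ ((1 : ℂ) - _) (pow_ne_zero 2 hx)]
    congr 1
    · linear_combination (-(ω * u x) + ω⁻¹ * u x) * mul_inv_cancel₀ hx
        + ω * ω⁻¹ * (1 + u x * (u x)⁻¹) * mul_inv_cancel₀ hx
    · linear_combination (1 + u x * (u x)⁻¹) * mul_inv_cancel₀ hx
  · norm_num

lemma tendsto_exp_inv : Tendsto (fun Λ : ℝ => ((Real.exp Λ : ℂ))⁻¹) atTop (nhds 0) := by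
  have h := (Complex.continuous_ofReal.tendsto 0).comp
    (tendsto_inv_atTop_zero.comp Real.tendsto_exp_atTop)
  simpa [Function.comp_def] using h

lemma ofReal_exp_ne_zero (Λ : ℝ) : (Real.exp Λ : ℂ) ≠ 0 :=
  Complex.ofReal_ne_zero.2 (Real.exp_ne_zero Λ)

lemma exp_neg_weight (k : ℕ → ℕ) (s : ℕ) (Λ : ℝ) :
    Complex.exp (-((∑ m ∈ Finset.Icc 1 s, m * k m : ℕ) : ℂ) * (Λ : ℂ)) =
      ∏ m ∈ Finset.Icc 1 s, (((Real.exp Λ : ℂ))⁻¹ ^ m) ^ k m := by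
  rw [Complex.ofReal_exp, ← Complex.exp_neg]
  simp only [← Complex.exp_nat_mul, ← Complex.exp_sum]
  push_cast
  rw [← Finset.sum_neg_distrib, Finset.sum_mul]
  congr 1
  exact Finset.sum_congr rfl fun m _ => by ring

lemma tendsto_Ph {l M : ℕ} (k : ℕ → ℕ) (s : ℕ) (X : Fin l → ℂ) (Y : Fin M → ℂ)
    (A : Finset (Fin l)) (B : Finset (Fin M)) :
    Tendsto (fun Λ : ℝ =>
      Complex.exp (-((∑ m ∈ Finset.Icc 1 s, m * k m : ℕ) : ℂ) * (Λ : ℂ)) *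
        Ph k s (Fin.append (fun i => (Real.exp Λ : ℂ) * X i) Y) (appendSet A B)
          (appendSet Aᶜ Bᶜ)) atTop (nhds (Ph k s X A Aᶜ)) := by
  simp only [exp_neg_weight, Ph, ← Finset.prod_mul_distrib, ← mul_pow, pS_append, pS_const_mul]
  refine tendsto_finsetProd _ fun m hm => Tendsto.pow ?_ _
  have hm0 : m ≠ 0 := by have := (Finset.mem_Icc.1 hm).1; omega
  have h := ((tendsto_exp_inv.pow m).mul_const
    (pS m Y B - (-1) ^ m * pS m Y Bᶜ)).const_add (pS m X A - (-1) ^ m * pS m X Aᶜ)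
  rw [zero_pow hm0, zero_mul, add_zero] at h
  refine h.congr fun Λ => ?_
  have he : ((Real.exp Λ : ℂ))⁻¹ ^ m * (Real.exp Λ : ℂ) ^ m = 1 := by
    rw [← mul_pow, inv_mul_cancel₀ (ofReal_exp_ne_zero Λ), one_pow]
  rw [zpow_natCast]
  linear_combination (-(pS m X A - (-1) ^ m * pS m X Aᶜ)) * he

lemma tendsto_Pbar {l M : ℕ} (kb : ℕ → ℕ) (t : ℕ) (X : Fin l → ℂ) (Y : Fin M → ℂ)
    (A : Finset (Fin l)) (B : Finset (Fin M)) :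
    Tendsto (fun Λ : ℝ =>
      Pbar kb t (Fin.append (fun i => (Real.exp Λ : ℂ) * X i) Y) (appendSet A B)
          (appendSet Aᶜ Bᶜ)) atTop (nhds (Pbar kb t Y B Bᶜ)) := by
  simp only [Pbar, pS_append, pS_const_mul]
  refine tendsto_finsetProd _ fun m hm => Tendsto.pow ?_ _
  have hm0 : m ≠ 0 := by have := (Finset.mem_Icc.1 hm).1; omega
  have h := ((tendsto_exp_inv.pow m).mul_const
    (pS (-(m : ℤ)) X Aᶜ - (-1) ^ m * pS (-(m : ℤ)) X A)).add_const
      (pS (-(m : ℤ)) Y Bᶜ - (-1) ^ m * pS (-(m : ℤ)) Y B)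
  rw [zero_pow hm0, zero_mul, zero_add] at h
  refine h.congr fun Λ => ?_
  rw [zpow_neg, zpow_natCast, inv_pow]
  ring

lemma tendsto_prod_ff {l M : ℕ} {ω : ℂ} (hω : ω ≠ 0) {X : Fin l → ℂ} {Y : Fin M → ℂ}
    (hX : ∀ i, X i ≠ 0) (hY : ∀ i, Y i ≠ 0) (A : Finset (Fin l)) (B : Finset (Fin M)) :
    Tendsto (fun Λ : ℝ => ∏ i ∈ appendSet A B, ∏ j ∈ appendSet Aᶜ Bᶜ,
      ff ω (Fin.append (fun i => (Real.exp Λ : ℂ) * X i) Y i /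
        Fin.append (fun i => (Real.exp Λ : ℂ) * X i) Y j)) atTop
      (nhds ((∏ i ∈ A, ∏ j ∈ Aᶜ, ff ω (X i / X j)) * ∏ i ∈ B, ∏ j ∈ Bᶜ, ff ω (Y i / Y j))) := by
  simp only [prod_appendSet, Fin.append_left, Fin.append_right,
    mul_div_mul_left _ _ (ofReal_exp_ne_zero _)]
  refine Tendsto.mul (tendsto_finsetProd _ fun i _ => ?_) (tendsto_finsetProd _ fun i _ => ?_)
  · have h : Tendsto (fun Λ : ℝ => ∏ j ∈ Bᶜ, ff ω ((Real.exp Λ : ℂ) * X i / Y j)) atTop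
        (nhds (∏ _j ∈ Bᶜ, 1)) := by
      refine tendsto_finsetProd _ fun j _ => tendsto_ff_of_inv
        (fun Λ => div_ne_zero (mul_ne_zero (ofReal_exp_ne_zero Λ) (hX i)) (hY j)) ?_
      have h := tendsto_exp_inv.mul_const (Y j / X i)
      rw [zero_mul] at h
      refine h.congr fun Λ => ?_
      rw [inv_div, mul_comm (Real.exp Λ : ℂ), ← div_div, div_eq_mul_inv _ (Real.exp Λ : ℂ),
        mul_comm]
    simpa using h.const_mul (∏ j ∈ Aᶜ, ff ω (X i / X j))
  · have h : Tendsto (fun Λ : ℝ => ∏ j ∈ Aᶜ, ff ω (Y i / ((Real.exp Λ : ℂ) * X j))) atTop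
        (nhds (∏ _j ∈ Aᶜ, 1)) := by
      refine tendsto_finsetProd _ fun j _ => tendsto_ff_zero hω ?_
      have h := tendsto_exp_inv.mul_const (Y i / X j)
      rw [zero_mul] at h
      refine h.congr fun Λ => ?_
      rw [mul_comm (Real.exp Λ : ℂ), ← div_div, div_eq_mul_inv _ (Real.exp Λ : ℂ), mul_comm]
    simpa using h.mul_const (∏ j ∈ Bᶜ, ff ω (Y i / Y j))

/-- cluster factorization property: if `h` is a partition of weight
`n = Σ_m m·k_m` and `h̄'` an antichiral partition, then for admissible tuples
`(x_1,…,x_l)` and `(x_{l+1},…,x_N)`,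
`lim_{Λ→+∞} e^{−nΛ}·J^g_{N,a}(e^Λ x_1,…,e^Λ x_l, x_{l+1},…,x_N)
  = J^h_{l,a}(x_1,…,x_l) · J^{h̄'}_{N−l,a}(x_{l+1},…,x_N)`. -/
theorem stmt19 (ω : ℂ) (hω : ω ≠ 0 ∧ ω ≠ 1 ∧ ω ≠ -1)
    (k : ℕ → ℕ) (s : ℕ) (kb : ℕ → ℕ) (t : ℕ) (a : ℂ)
    (l M : ℕ) (X : Fin l → ℂ) (Y : Fin M → ℂ)
    (hX : Admissible X) (hY : Admissible Y) :
    Filter.Tendsto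
      (fun Λ : ℝ =>
        Complex.exp (-((∑ m ∈ Finset.Icc 1 s, m * k m : ℕ) : ℂ) * (Λ : ℂ)) *
          Jg ω k s kb t a (Fin.append (fun i => (Real.exp Λ : ℂ) * X i) Y))
      Filter.atTop
      (nhds (J ω k s a X * Jbar ω kb t a Y)) := by
  simp only [Jg, J, Jbar, sum_finset_append, compl_appendSet, card_appendSet, phase_add,
    Finset.sum_mul_sum]
  simp only [Finset.mul_sum]
  refine tendsto_finsetSum _ fun A _ => tendsto_finsetSum _ fun B _ => ?_
  have h := (((tendsto_Ph k s X Y A B).mul (tendsto_Pbar kb t X Y A B)).mul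
    (tendsto_prod_ff hω.1 hX.1 hY.1 A B)).const_mul (phase a l A.card * phase a M B.card)
  convert h using 2 <;> ring
end
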